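/- Fix d ≥ 1 and k ∈ ℕ, and let K be a compact subset of the pseudometric space (M^L(ℝ^d), d_WL^(k)) of ℝ^d-labeled measure Markov chains on finite state spaces. Then the set NN_k(ℝ^d)|_K of restrictions to K of k-layer Markov chain neural networks is dense (with respect to the supremum norm) in the space C(K,ℝ) of continuous real-valued functions on K; i.e. its closure equals C(K,ℝ). -/

import Mathlib

open Finset

noncomputable section

/-- `π` is a coupling of the two probability vectors `p : A → ℝ` and `p' : B → ℝ`. -/
def IsCouplingFn {A B : Type*} [Fintype A] [Fintype B] (π : A × B → ℝ)
    (p : A → ℝ) (p' : B → ℝ) : Prop :=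
  (∀ r, 0 ≤ π r) ∧ (∀ a, ∑ b, π (a, b) = p a) ∧ (∀ b, ∑ a, π (a, b) = p' b)

/-- A 1-step coupling between the Markov kernels `mA` and `mB`. -/
def IsOneStepCoupling {A B : Type*} [Fintype A] [Fintype B]
    (mA : A → A → ℝ) (mB : B → B → ℝ) (ν : A × B → A × B → ℝ) : Prop :=
  ∀ p, IsCouplingFn (ν p) (mA p.1) (mB p.2)

/-- `k`-step couplings between the Markov kernels `mA` and `mB` (for `k = 0`, the identity
kernel, so that `ν^{(0)} ⊙ γ = γ`). -/
inductive IsKStepCoupling {A B : Type*} [Fintype A] [Fintype B] [DecidableEq A] [DecidableEq B]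
    (mA : A → A → ℝ) (mB : B → B → ℝ) : ℕ → (A × B → A × B → ℝ) → Prop
  | zero (ν : A × B → A × B → ℝ) (h : ∀ p r, ν p r = if r = p then 1 else 0) :
      IsKStepCoupling mA mB 0 ν
  | one (ν : A × B → A × B → ℝ) (h : IsOneStepCoupling mA mB ν) : IsKStepCoupling mA mB 1 ν
  | succ (k : ℕ) (ν' ν₁ ν : A × B → A × B → ℝ) (h' : IsKStepCoupling mA mB k ν')
      (h₁ : IsOneStepCoupling mA mB ν₁) (h : ∀ p r, ν p r = ∑ s, ν₁ p s * ν' s r) :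
      IsKStepCoupling mA mB (k + 1) ν

/-- `ν ⊙ γ := ∫ ν_{x,y} γ(dx×dy)`. -/
def odotFn {A B : Type*} [Fintype A] [Fintype B]
    (ν : A × B → A × B → ℝ) (γ : A × B → ℝ) : A × B → ℝ :=
  fun r => ∑ p, γ p * ν p r

/-- The Weisfeiler–Lehman distance of depth `k` between two labeled measure Markov chains on
finite state spaces, via its `k`-step coupling characterization: the infimum over
`γ^{(k)} = ν^{(k)} ⊙ γ ∈ C^{(k)}(μ_A,μ_B)` of `∫ d_Z(ℓ_A(x),ℓ_B(y)) γ^{(k)}(dx×dy)`. -/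
def dWL {A B Z : Type*} [Fintype A] [Fintype B] [DecidableEq A] [DecidableEq B]
    [PseudoMetricSpace Z] (k : ℕ)
    (mA : A → A → ℝ) (μA : A → ℝ) (lA : A → Z)
    (mB : B → B → ℝ) (μB : B → ℝ) (lB : B → Z) : ℝ :=
  sInf {r : ℝ | ∃ γ ν, IsCouplingFn γ μA μB ∧ IsKStepCoupling mA mB k ν ∧
    r = ∑ p : A × B, odotFn ν γ p * dist (lA p.1) (lB p.2)}

/-- An ℝ^d-labeled measure Markov chain on a finite state space `Fin n` (data). -/
structure FinLMMC (d : ℕ) where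
  n : ℕ
  kernel : Fin n → Fin n → ℝ
  μ : Fin n → ℝ
  label : Fin n → EuclideanSpace ℝ (Fin d)

/-- The data of a `FinLMMC` is a genuine labeled measure Markov chain: the kernel is a
Markov kernel and `μ` is a stationary probability measure for it. -/
def IsLMMC {d : ℕ} (M : FinLMMC d) : Prop :=
  (∀ x x', 0 ≤ M.kernel x x') ∧ (∀ x, ∑ x', M.kernel x x' = 1) ∧
  (∀ x, 0 ≤ M.μ x) ∧ (∑ x, M.μ x = 1) ∧
  (∀ x', ∑ x, M.μ x * M.kernel x x' = M.μ x')

/-- The WL distance of depth `k` between two labeled measure Markov chains. -/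
def dWLM {d : ℕ} (k : ℕ) (M₁ M₂ : FinLMMC d) : ℝ :=
  dWL k M₁.kernel M₁.μ M₁.label M₂.kernel M₂.μ M₂.label

/-- Dimension sequence with prescribed initial value `d` and tail `t`. -/
def dimSeq (d : ℕ) (t : ℕ → ℕ) : ℕ → ℕ
  | 0 => d
  | i + 1 => t i

/-- The labels computed by the layers `F_{φ_1}, …` of a Markov chain neural network:
`ℓ_X^{φ}(x) := q_φ((ℓ_X)_# m^X_x) = Σ_{x'} m^X_x(x') φ(ℓ_X(x'))` (here `φ i` is the paper's
`φ_{i+1}`). -/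
def mcnnLabel (dims : ℕ → ℕ)
    (φ : (i : ℕ) → EuclideanSpace ℝ (Fin (dims i)) → EuclideanSpace ℝ (Fin (dims (i + 1))))
    (M : FinLMMC (dims 0)) : (i : ℕ) → Fin M.n → EuclideanSpace ℝ (Fin (dims i))
  | 0, x => M.label x
  | i + 1, x => ∑ x', M.kernel x x' • φ i (mcnnLabel dims φ M i x')

/-- The output of a `k`-layer Markov chain neural network
`H = ψ ∘ S_{φ_{k+1}} ∘ F_{φ_k} ∘ ⋯ ∘ F_{φ_1}`:
`H(M) = ψ( Σ_x μ_X(x) φ_{k+1}(ℓ_X^{(k)}(x)) )`. -/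
def mcnnOut (dims : ℕ → ℕ) (k : ℕ)
    (φ : (i : ℕ) → EuclideanSpace ℝ (Fin (dims i)) → EuclideanSpace ℝ (Fin (dims (i + 1))))
    (ψ : EuclideanSpace ℝ (Fin (dims (k + 1))) → ℝ)
    (M : FinLMMC (dims 0)) : ℝ :=
  ψ (∑ x, M.μ x • φ k (mcnnLabel dims φ M k x))

/-- Compactness (in the sequentially compact form, equivalent to compactness for
pseudometric spaces) of a set `K` with respect to a pseudo-distance function `dd`. -/
def SeqCompactIn {A : Type*} (dd : A → A → ℝ) (K : Set A) : Prop :=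
  ∀ u : ℕ → A, (∀ n, u n ∈ K) → ∃ a ∈ K, ∃ s : ℕ → ℕ, StrictMono s ∧
    Filter.Tendsto (fun n => dd (u (s n)) a) Filter.atTop (nhds 0)

/-- Continuity of `f` on `K` with respect to the pseudo-distance `dd`. -/
def ContinuousOnPD {A : Type*} (dd : A → A → ℝ) (K : Set A) (f : A → ℝ) : Prop :=
  ∀ a ∈ K, ∀ ε > 0, ∃ δ > 0, ∀ b ∈ K, dd a b < δ → |f a - f b| < ε

end

noncomputable section

section Lipschitz

theorem Set.Finite.exists_lipschitzWith_eqOn {α E : Type*} [MetricSpace α]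
    [NormedAddCommGroup E] [NormedSpace ℝ E] [FiniteDimensional ℝ E] {s : Set α}
    (hs : s.Finite) (f : α → E) :
    ∃ g : α → E, (∃ c, LipschitzWith c g) ∧ Set.EqOn f g s := by
  have hf : LipschitzOnWith (∑ p ∈ hs.toFinset ×ˢ hs.toFinset,
      nndist (f p.1) (f p.2) / nndist p.1 p.2) f s := by
    refine LipschitzOnWith.of_dist_le_mul fun x hx y hy => ?_
    rcases eq_or_ne x y with rfl | hxy
    · simp
    have hle : nndist (f x) (f y) / nndist x y ≤ ∑ p ∈ hs.toFinset ×ˢ hs.toFinset,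
        nndist (f p.1) (f p.2) / nndist p.1 p.2 :=
      single_le_sum (f := fun p : α × α => nndist (f p.1) (f p.2) / nndist p.1 p.2)
        (fun _ _ => zero_le) (a := (x, y)) (by simp [hx, hy])
    have hpos : nndist x y ≠ 0 := by simpa using hxy
    have : nndist (f x) (f y) ≤ (∑ p ∈ hs.toFinset ×ˢ hs.toFinset,
        nndist (f p.1) (f p.2) / nndist p.1 p.2) * nndist x y := by
      calc nndist (f x) (f y) = nndist (f x) (f y) / nndist x y * nndist x y := by
            rw [div_mul_cancel₀ _ hpos]
        _ ≤ _ := by gcongr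
    exact_mod_cast this
  obtain ⟨g, hg, hgf⟩ := hf.extend_finite_dimension
  exact ⟨g, ⟨_, hg⟩, hgf⟩

end Lipschitz

section Couplings

variable {A B : Type*} [Fintype A] [Fintype B]

theorem IsCouplingFn.sum_smul_sub {E : Type*} [AddCommGroup E] [Module ℝ E] {π : A × B → ℝ}
    {p : A → ℝ} {p' : B → ℝ} (h : IsCouplingFn π p p') (g : A → E) (g' : B → E) :
    ∑ a, p a • g a - ∑ b, p' b • g' b = ∑ r, π r • (g r.1 - g' r.2) := by
  simp_rw [smul_sub, sum_sub_distrib]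
  congr 1
  · rw [Fintype.sum_prod_type]
    simp_rw [← sum_smul, h.2.1]
  · rw [Fintype.sum_prod_type_right]
    simp_rw [← sum_smul, h.2.2]

theorem IsCouplingFn.norm_sum_smul_sub_le {E : Type*} [SeminormedAddCommGroup E]
    [NormedSpace ℝ E] {π : A × B → ℝ} {p : A → ℝ} {p' : B → ℝ} (h : IsCouplingFn π p p')
    {g : A → E} {g' : B → E} {D : A × B → ℝ} (hD : ∀ r, ‖g r.1 - g' r.2‖ ≤ D r) :
    ‖∑ a, p a • g a - ∑ b, p' b • g' b‖ ≤ ∑ r, π r * D r := by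
  rw [h.sum_smul_sub]
  refine (norm_sum_le _ _).trans (sum_le_sum fun r _ => ?_)
  rw [norm_smul, Real.norm_of_nonneg (h.1 r)]
  exact mul_le_mul_of_nonneg_left (hD r) (h.1 r)

theorem IsCouplingFn.swap {π : A × B → ℝ} {p : A → ℝ} {p' : B → ℝ} (h : IsCouplingFn π p p') :
    IsCouplingFn (fun r : B × A => π r.swap) p' p :=
  ⟨fun r => h.1 r.swap, h.2.2, h.2.1⟩

theorem isCouplingFn_mul {p : A → ℝ} {p' : B → ℝ} (hp : ∀ a, 0 ≤ p a) (hp' : ∀ b, 0 ≤ p' b)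
    (hp1 : ∑ a, p a = 1) (hp1' : ∑ b, p' b = 1) :
    IsCouplingFn (fun r : A × B => p r.1 * p' r.2) p p' := by
  refine ⟨fun r => mul_nonneg (hp _) (hp' _), fun a => ?_, fun b => ?_⟩
  · simp [← mul_sum, hp1']
  · simp [← sum_mul, hp1]

/-- Two nonnegative vectors giving the same mass to every colour class admit a coupling
supported on pairs of equal colour. -/
theorem exists_isCouplingFn_of_colour {Z : Type*} [DecidableEq Z] {p : A → ℝ} {p' : B → ℝ}
    (hp : ∀ a, 0 ≤ p a) (hp' : ∀ b, 0 ≤ p' b) {c : A → Z} {c' : B → Z}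
    (hA : ∀ a₀, (∑ a, if c a = c a₀ then p a else 0) = ∑ b, if c' b = c a₀ then p' b else 0)
    (hB : ∀ b₀, (∑ a, if c a = c' b₀ then p a else 0) = ∑ b, if c' b = c' b₀ then p' b else 0) :
    ∃ π : A × B → ℝ, IsCouplingFn π p p' ∧ ∀ r, π r ≠ 0 → c r.1 = c' r.2 := by
  set W : Z → ℝ := fun z => ∑ b, if c' b = z then p' b else 0 with hW
  have hW0 : ∀ z, 0 ≤ W z := fun z => sum_nonneg fun b _ => by split_ifs <;> simp [hp']
  refine ⟨fun r => if c r.1 = c' r.2 then p r.1 * p' r.2 / W (c r.1) else 0,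
    ⟨fun r => ?_, fun a => ?_, fun b => ?_⟩, fun r hr => ?_⟩
  · dsimp only
    split_ifs
    · exact div_nonneg (mul_nonneg (hp _) (hp' _)) (hW0 _)
    · exact le_rfl
  · have : ∀ b, (if c a = c' b then p a * p' b / W (c a) else 0)
        = p a / W (c a) * if c' b = c a then p' b else 0 := fun b => by
      by_cases h : c' b = c a
      · simp only [h, if_true]; ring
      · simp [h, Ne.symm h]
    simp_rw [this, ← mul_sum]
    change p a / W (c a) * W (c a) = p a
    by_cases h : W (c a) = 0
    · have h0 : p a = 0 := by
        have hs := (sum_eq_zero_iff_of_nonneg fun x _ => by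
          split_ifs <;> simp [hp]).1 ((hA a).trans h) a (mem_univ _)
        simpa using hs
      simp [h0]
    · exact div_mul_cancel₀ _ h
  · have : ∀ a, (if c a = c' b then p a * p' b / W (c a) else 0)
        = p' b / W (c' b) * if c a = c' b then p a else 0 := fun a => by
      by_cases h : c a = c' b
      · simp only [h, if_true]; ring
      · simp [h]
    simp_rw [this, ← mul_sum]
    rw [hB b]
    change p' b / W (c' b) * W (c' b) = p' b
    by_cases h : W (c' b) = 0
    · have h0 : p' b = 0 := by
        have hs := (sum_eq_zero_iff_of_nonneg fun x _ => by
          split_ifs <;> simp [hp']).1 h b (mem_univ _)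
        simpa using hs
      simp [h0]
    · exact div_mul_cancel₀ _ h
  · by_contra h
    simp [h] at hr

theorem IsOneStepCoupling.swap {mA : A → A → ℝ} {mB : B → B → ℝ} {ν : A × B → A × B → ℝ}
    (h : IsOneStepCoupling mA mB ν) :
    IsOneStepCoupling mB mA fun p r => ν p.swap r.swap :=
  fun p => (h p.swap).swap

variable [DecidableEq A] [DecidableEq B] {mA : A → A → ℝ} {mB : B → B → ℝ}

theorem IsKStepCoupling.swap {k : ℕ} {ν : A × B → A × B → ℝ} (h : IsKStepCoupling mA mB k ν) :
    IsKStepCoupling mB mA k fun p r => ν p.swap r.swap := by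
  induction h with
  | zero ν h => exact .zero _ fun p r => by simp [h, Prod.swap_inj]
  | one ν h => exact .one _ h.swap
  | succ k ν' ν₁ ν _ h₁ h ih =>
    refine .succ k _ _ _ ih h₁.swap fun p r => ?_
    rw [h]
    exact ((Equiv.prodComm B A).sum_comp fun s => ν₁ p.swap s * ν' s r.swap).symm

theorem IsKStepCoupling.nonneg {k : ℕ} {ν : A × B → A × B → ℝ}
    (h : IsKStepCoupling mA mB k ν) (p r : A × B) : 0 ≤ ν p r := by
  induction h generalizing p r with
  | zero ν h => rw [h]; split_ifs <;> simp
  | one ν h => exact (h p).1 r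
  | succ k ν' ν₁ ν _ h₁ h ih =>
    rw [h]
    exact sum_nonneg fun s _ => mul_nonneg ((h₁ p).1 s) (ih s r)

theorem IsKStepCoupling.exists_eq_sum {k : ℕ} {ν : A × B → A × B → ℝ}
    (h : IsKStepCoupling mA mB (k + 1) ν) :
    ∃ ν' ν₁, IsKStepCoupling mA mB k ν' ∧ IsOneStepCoupling mA mB ν₁ ∧
      ∀ p r, ν p r = ∑ s, ν₁ p s * ν' s r := by
  cases h with
  | one _ h => exact ⟨_, ν, .zero (fun p r => if r = p then 1 else 0) fun _ _ => rfl, h, by simp⟩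
  | succ _ ν' ν₁ _ h' h₁ h => exact ⟨ν', ν₁, h', h₁, h⟩

theorem IsOneStepCoupling.exists_isKStepCoupling {ν₁ : A × B → A × B → ℝ}
    (h : IsOneStepCoupling mA mB ν₁) (k : ℕ) : ∃ ν, IsKStepCoupling mA mB k ν := by
  induction k with
  | zero => exact ⟨_, .zero (fun p r => if r = p then 1 else 0) fun _ _ => rfl⟩
  | succ k ih =>
    obtain ⟨ν', h'⟩ := ih
    exact ⟨_, .succ k ν' ν₁ _ h' h fun _ _ => rfl⟩

end Couplings

section Distance

variable {d : ℕ}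

/-- The costs of the depth-`k` couplings of two labeled Markov chains. -/
def couplingCosts (k : ℕ) (M N : FinLMMC d) : Set ℝ :=
  {r : ℝ | ∃ γ ν, IsCouplingFn γ M.μ N.μ ∧ IsKStepCoupling M.kernel N.kernel k ν ∧
    r = ∑ p : Fin M.n × Fin N.n, odotFn ν γ p * dist (M.label p.1) (N.label p.2)}

theorem dWLM_eq_sInf (k : ℕ) (M N : FinLMMC d) : dWLM k M N = sInf (couplingCosts k M N) := rfl

theorem nonneg_of_mem_couplingCosts {k : ℕ} {M N : FinLMMC d} {r : ℝ}
    (hr : r ∈ couplingCosts k M N) : 0 ≤ r := by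
  obtain ⟨γ, ν, hγ, hν, rfl⟩ := hr
  exact sum_nonneg fun p _ => mul_nonneg
    (sum_nonneg fun q _ => mul_nonneg (hγ.1 q) (hν.nonneg q p)) dist_nonneg

theorem couplingCosts_subset_swap (k : ℕ) (M N : FinLMMC d) :
    couplingCosts k M N ⊆ couplingCosts k N M := by
  rintro r ⟨γ, ν, hγ, hν, rfl⟩
  refine ⟨_, _, hγ.swap, hν.swap, ?_⟩
  rw [← (Equiv.prodComm (Fin N.n) (Fin M.n)).sum_comp]
  refine sum_congr rfl fun p _ => ?_
  rw [dist_comm]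
  congr 1
  exact ((Equiv.prodComm (Fin N.n) (Fin M.n)).sum_comp fun q => γ q * ν q p.swap).symm

theorem dWLM_comm (k : ℕ) (M N : FinLMMC d) : dWLM k M N = dWLM k N M := by
  rw [dWLM_eq_sInf, dWLM_eq_sInf, (couplingCosts_subset_swap k M N).antisymm
    (couplingCosts_subset_swap k N M)]

theorem dWLM_nonneg (k : ℕ) (M N : FinLMMC d) : 0 ≤ dWLM k M N :=
  Real.sInf_nonneg fun _ => nonneg_of_mem_couplingCosts

theorem couplingCosts_nonempty (k : ℕ) {M N : FinLMMC d} (hM : IsLMMC M) (hN : IsLMMC N) :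
    (couplingCosts k M N).Nonempty := by
  obtain ⟨hM1, hM2, hM3, hM4, -⟩ := hM
  obtain ⟨hN1, hN2, hN3, hN4, -⟩ := hN
  have h₁ : IsOneStepCoupling M.kernel N.kernel
      fun p r => M.kernel p.1 r.1 * N.kernel p.2 r.2 :=
    fun p => isCouplingFn_mul (hM1 _) (hN1 _) (hM2 _) (hN2 _)
  obtain ⟨ν, hν⟩ := h₁.exists_isKStepCoupling k
  exact ⟨_, _, ν, isCouplingFn_mul hM3 hN3 hM4 hN4, hν, rfl⟩

end Distance

section LipschitzContinuity

variable {dims : ℕ → ℕ}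
  {φ : (i : ℕ) → EuclideanSpace ℝ (Fin (dims i)) → EuclideanSpace ℝ (Fin (dims (i + 1)))}

theorem exists_norm_mcnnLabel_sub_le (hφ : ∀ i, ∃ c : NNReal, LipschitzWith c (φ i)) (i : ℕ) :
    ∃ C : ℝ, 0 ≤ C ∧ ∀ (M N : FinLMMC (dims 0)) (ν),
      IsKStepCoupling M.kernel N.kernel i ν → ∀ p,
        ‖mcnnLabel dims φ M i p.1 - mcnnLabel dims φ N i p.2‖ ≤
          C * ∑ r, ν p r * dist (M.label r.1) (N.label r.2) := by
  induction i with
  | zero =>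
    refine ⟨1, zero_le_one, fun M N ν hν p => ?_⟩
    cases hν with
    | zero _ h => simp [h, mcnnLabel, dist_eq_norm]
  | succ i ih =>
    obtain ⟨C, hC, ih⟩ := ih
    obtain ⟨c, hc⟩ := hφ i
    refine ⟨c * C, by positivity, fun M N ν hν p => ?_⟩
    obtain ⟨ν', ν₁, hν', hν₁, hν⟩ := hν.exists_eq_sum
    refine ((hν₁ p).norm_sum_smul_sub_le (D := fun s =>
      c * (C * ∑ r, ν' s r * dist (M.label r.1) (N.label r.2))) fun s => ?_).trans_eq ?_
    · rw [← dist_eq_norm]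
      refine (hc.dist_le_mul _ _).trans ?_
      rw [dist_eq_norm]
      gcongr
      exact ih M N ν' hν' s
    · simp_rw [hν, sum_mul, mul_sum]
      rw [sum_comm]
      refine sum_congr rfl fun r _ => sum_congr rfl fun s _ => ?_
      ring

theorem exists_abs_mcnnOut_sub_le (hφ : ∀ i, ∃ c : NNReal, LipschitzWith c (φ i)) (k : ℕ)
    {ψ : EuclideanSpace ℝ (Fin (dims (k + 1))) → ℝ} (hψ : ∃ c : NNReal, LipschitzWith c ψ) :
    ∃ C : ℝ, 0 < C ∧ ∀ M N : FinLMMC (dims 0), IsLMMC M → IsLMMC N →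
      |mcnnOut dims k φ ψ M - mcnnOut dims k φ ψ N| ≤ C * dWLM k M N := by
  obtain ⟨C, hC, hCle⟩ := exists_norm_mcnnLabel_sub_le hφ k
  obtain ⟨c, hc⟩ := hφ k
  obtain ⟨b, hb⟩ := hψ
  refine ⟨b * (c * C) + 1, by positivity, fun M N hM hN => ?_⟩
  rw [← div_le_iff₀' (by positivity), dWLM_eq_sInf]
  refine le_csInf (couplingCosts_nonempty k hM hN) fun r hr => ?_
  have hr0 := nonneg_of_mem_couplingCosts hr
  rw [div_le_iff₀' (by positivity)]
  obtain ⟨γ, ν, hγ, hν, hrr⟩ := hr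
  have hsum : ‖∑ x, M.μ x • φ k (mcnnLabel dims φ M k x)
      - ∑ x, N.μ x • φ k (mcnnLabel dims φ N k x)‖ ≤ c * C * r := by
    refine (hγ.norm_sum_smul_sub_le (D := fun s =>
      c * (C * ∑ r, ν s r * dist (M.label r.1) (N.label r.2))) fun s => ?_).trans_eq ?_
    · rw [← dist_eq_norm]
      refine (hc.dist_le_mul _ _).trans ?_
      rw [dist_eq_norm]
      gcongr
      exact hCle M N ν hν s
    · simp_rw [hrr, odotFn, sum_mul, mul_sum]
      rw [sum_comm]
      refine sum_congr rfl fun r _ => sum_congr rfl fun s _ => ?_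
      ring
  calc |mcnnOut dims k φ ψ M - mcnnOut dims k φ ψ N| ≤ b * (c * C * r) := by
        rw [← Real.dist_eq]
        refine (hb.dist_le_mul _ _).trans ?_
        rw [dist_eq_norm]
        gcongr
    _ ≤ (b * (c * C) + 1) * r := by linarith

end LipschitzContinuity

section DirectSum

/-- The direct sum of two Euclidean spaces, as a Euclidean space. -/
def euclideanProd (a b : ℕ) :
    (EuclideanSpace ℝ (Fin a) × EuclideanSpace ℝ (Fin b)) ≃L[ℝ] EuclideanSpace ℝ (Fin (a + b)) :=
  ContinuousLinearEquiv.ofFinrankEq (by simp)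

variable {d : ℕ} {t₁ t₂ : ℕ → ℕ}

/-- The layers of the direct sum of two Markov chain neural networks. -/
def prodLayer
    (φ₁ : (i : ℕ) → EuclideanSpace ℝ (Fin (dimSeq d t₁ i)) →
      EuclideanSpace ℝ (Fin (dimSeq d t₁ (i + 1))))
    (φ₂ : (i : ℕ) → EuclideanSpace ℝ (Fin (dimSeq d t₂ i)) →
      EuclideanSpace ℝ (Fin (dimSeq d t₂ (i + 1)))) :
    (i : ℕ) → EuclideanSpace ℝ (Fin (dimSeq d (fun j => t₁ j + t₂ j) i)) →
      EuclideanSpace ℝ (Fin (dimSeq d (fun j => t₁ j + t₂ j) (i + 1)))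
  | 0 => fun v => euclideanProd (t₁ 0) (t₂ 0) (φ₁ 0 v, φ₂ 0 v)
  | i + 1 => fun v => euclideanProd (t₁ (i + 1)) (t₂ (i + 1))
      (φ₁ (i + 1) ((euclideanProd (t₁ i) (t₂ i)).symm v).1,
        φ₂ (i + 1) ((euclideanProd (t₁ i) (t₂ i)).symm v).2)

variable
  {φ₁ : (i : ℕ) → EuclideanSpace ℝ (Fin (dimSeq d t₁ i)) →
    EuclideanSpace ℝ (Fin (dimSeq d t₁ (i + 1)))}
  {φ₂ : (i : ℕ) → EuclideanSpace ℝ (Fin (dimSeq d t₂ i)) →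
    EuclideanSpace ℝ (Fin (dimSeq d t₂ (i + 1)))}

theorem exists_lipschitzWith_prodLayer (h₁ : ∀ i, ∃ c : NNReal, LipschitzWith c (φ₁ i))
    (h₂ : ∀ i, ∃ c : NNReal, LipschitzWith c (φ₂ i)) (i : ℕ) :
    ∃ c : NNReal, LipschitzWith c (prodLayer φ₁ φ₂ i) := by
  obtain ⟨c₁, hc₁⟩ := h₁ i
  obtain ⟨c₂, hc₂⟩ := h₂ i
  cases i with
  | zero => exact ⟨_, (euclideanProd (t₁ 0) (t₂ 0)).lipschitz.comp (hc₁.prodMk hc₂)⟩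
  | succ i =>
    exact ⟨_, (euclideanProd (t₁ (i + 1)) (t₂ (i + 1))).lipschitz.comp
      ((hc₁.comp (LipschitzWith.prod_fst.comp (euclideanProd (t₁ i) (t₂ i)).symm.lipschitz)).prodMk
        (hc₂.comp (LipschitzWith.prod_snd.comp (euclideanProd (t₁ i) (t₂ i)).symm.lipschitz)))⟩

theorem sum_smul_euclideanProd {A : Type*} [Fintype A] {a b : ℕ} (p : A → ℝ)
    (u : A → EuclideanSpace ℝ (Fin a)) (v : A → EuclideanSpace ℝ (Fin b)) :
    ∑ x, p x • euclideanProd a b (u x, v x)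
      = euclideanProd a b (∑ x, p x • u x, ∑ x, p x • v x) := by
  simp_rw [← map_smul, ← map_sum]
  congr 1
  ext1 <;> simp [Prod.fst_sum, Prod.snd_sum]

theorem prodLayer_mcnnLabel (M : FinLMMC d) (i : ℕ) (x : Fin M.n) :
    prodLayer φ₁ φ₂ i (mcnnLabel (dimSeq d fun j => t₁ j + t₂ j) (prodLayer φ₁ φ₂) M i x)
      = euclideanProd (t₁ i) (t₂ i) (φ₁ i (mcnnLabel (dimSeq d t₁) φ₁ M i x),
          φ₂ i (mcnnLabel (dimSeq d t₂) φ₂ M i x)) := by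
  induction i generalizing x with
  | zero => rfl
  | succ i ih =>
    have h : mcnnLabel (dimSeq d fun j => t₁ j + t₂ j) (prodLayer φ₁ φ₂) M (i + 1) x
        = euclideanProd (t₁ i) (t₂ i) (mcnnLabel (dimSeq d t₁) φ₁ M (i + 1) x,
          mcnnLabel (dimSeq d t₂) φ₂ M (i + 1) x) := by
      refine Eq.trans ?_ (sum_smul_euclideanProd (M.kernel x) _ _)
      exact sum_congr rfl fun x' _ => congrArg _ (ih x')
    rw [h]
    simp only [prodLayer, ContinuousLinearEquiv.symm_apply_apply]
    rfl

end DirectSum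

section Networks

/-- The functions computed by `k`-layer Markov chain neural networks. -/
def IsMCNN (d k : ℕ) (h : FinLMMC d → ℝ) : Prop :=
  ∃ (t : ℕ → ℕ)
    (φ : (i : ℕ) → EuclideanSpace ℝ (Fin (dimSeq d t i)) →
      EuclideanSpace ℝ (Fin (dimSeq d t (i + 1))))
    (ψ : EuclideanSpace ℝ (Fin (dimSeq d t (k + 1))) → ℝ),
    (∀ i, ∃ c : NNReal, LipschitzWith c (φ i)) ∧ (∃ c : NNReal, LipschitzWith c ψ) ∧
    ∀ M, h M = mcnnOut (dimSeq d t) k φ ψ M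

variable {d k : ℕ}

theorem IsMCNN.comp₂ {h₁ h₂ : FinLMMC d → ℝ} (H₁ : IsMCNN d k h₁) (H₂ : IsMCNN d k h₂)
    {F : ℝ × ℝ → ℝ} {c : NNReal} (hF : LipschitzWith c F) :
    IsMCNN d k fun M => F (h₁ M, h₂ M) := by
  obtain ⟨t₁, φ₁, ψ₁, hφ₁, ⟨c₁, hψ₁⟩, H₁⟩ := H₁
  obtain ⟨t₂, φ₂, ψ₂, hφ₂, ⟨c₂, hψ₂⟩, H₂⟩ := H₂
  refine ⟨fun j => t₁ j + t₂ j, prodLayer φ₁ φ₂,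
    fun v => F (ψ₁ ((euclideanProd (t₁ k) (t₂ k)).symm v).1,
      ψ₂ ((euclideanProd (t₁ k) (t₂ k)).symm v).2),
    exists_lipschitzWith_prodLayer hφ₁ hφ₂, ⟨_, hF.comp
      ((hψ₁.comp (LipschitzWith.prod_fst.comp (euclideanProd (t₁ k) (t₂ k)).symm.lipschitz)).prodMk
        (hψ₂.comp (LipschitzWith.prod_snd.comp (euclideanProd (t₁ k) (t₂ k)).symm.lipschitz)))⟩,
    fun M => ?_⟩
  have h : ∑ x, M.μ x • prodLayer φ₁ φ₂ k
        (mcnnLabel (dimSeq d fun j => t₁ j + t₂ j) (prodLayer φ₁ φ₂) M k x)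
      = euclideanProd (t₁ k) (t₂ k)
        (∑ x, M.μ x • φ₁ k (mcnnLabel (dimSeq d t₁) φ₁ M k x),
          ∑ x, M.μ x • φ₂ k (mcnnLabel (dimSeq d t₂) φ₂ M k x)) := by
    refine Eq.trans ?_ (sum_smul_euclideanProd M.μ _ _)
    exact sum_congr rfl fun x _ => congrArg _ (prodLayer_mcnnLabel M k x)
  simp only [H₁, H₂, mcnnOut]
  rw [h]
  simp only [ContinuousLinearEquiv.symm_apply_apply]
  rfl

theorem IsMCNN.exists_abs_sub_le {h : FinLMMC d → ℝ} (H : IsMCNN d k h) :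
    ∃ C : ℝ, 0 < C ∧ ∀ M N, IsLMMC M → IsLMMC N → |h M - h N| ≤ C * dWLM k M N := by
  obtain ⟨t, φ, ψ, hφ, hψ, H⟩ := H
  obtain ⟨C, hC, hle⟩ := exists_abs_mcnnOut_sub_le hφ k hψ
  exact ⟨C, hC, fun M N hM hN => by rw [H, H]; exact hle M N hM hN⟩

theorem isMCNN_const (a : ℝ) : IsMCNN d k fun _ => a :=
  ⟨fun _ => 0, fun _ _ => 0, fun _ => a, fun _ => ⟨0, LipschitzWith.const _⟩,
    ⟨0, LipschitzWith.const _⟩, fun _ => rfl⟩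

end Networks

section Separation

open Classical in
/-- The vector recording which of the colours `ζ j` equal `v`. -/
def colourIndicator {Z : Type*} {n : ℕ} (ζ : Fin n → Z) (v : Z) : EuclideanSpace ℝ (Fin n) :=
  WithLp.toLp 2 fun j => if v = ζ j then 1 else 0

theorem exists_isCouplingFn_of_sum_colourIndicator {A B Z : Type*} [Fintype A] [Fintype B]
    {n : ℕ} {ζ : Fin n → Z} {p : A → ℝ} {p' : B → ℝ} (hp : ∀ a, 0 ≤ p a) (hp' : ∀ b, 0 ≤ p' b)
    {c : A → Z} {c' : B → Z} (hc : ∀ a, ∃ j, ζ j = c a) (hc' : ∀ b, ∃ j, ζ j = c' b)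
    (h : ∑ a, p a • colourIndicator ζ (c a) = ∑ b, p' b • colourIndicator ζ (c' b)) :
    ∃ π : A × B → ℝ, IsCouplingFn π p p' ∧ ∀ r, π r ≠ 0 → c r.1 = c' r.2 := by
  classical
  have hj : ∀ j, (∑ a, if c a = ζ j then p a else 0) = ∑ b, if c' b = ζ j then p' b else 0 := by
    intro j
    simpa [colourIndicator] using congrArg (fun v : EuclideanSpace ℝ (Fin n) => v j) h
  refine exists_isCouplingFn_of_colour hp hp' (fun a => ?_) fun b => ?_
  · obtain ⟨j, hj'⟩ := hc a
    simpa only [hj'] using hj j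
  · obtain ⟨j, hj'⟩ := hc' b
    simpa only [hj'] using hj j

variable {d : ℕ}

/-- The Weisfeiler–Lehman colours of the states of two chains, encoded as vectors: the colour
at depth `i + 1` records the masses given by the kernel to the colour classes at depth `i`. -/
def wlColour (M N : FinLMMC d) :
    (i : ℕ) → Fin M.n ⊕ Fin N.n → EuclideanSpace ℝ (Fin (dimSeq d (fun _ => M.n + N.n) i))
  | 0, .inl x => M.label x
  | 0, .inr y => N.label y
  | i + 1, .inl x => ∑ x', M.kernel x x' •
      colourIndicator (wlColour M N i ∘ finSumFinEquiv.symm) (wlColour M N i (.inl x'))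
  | i + 1, .inr y => ∑ y', N.kernel y y' •
      colourIndicator (wlColour M N i ∘ finSumFinEquiv.symm) (wlColour M N i (.inr y'))

theorem exists_finSumFinEquiv_symm_eq {m n : ℕ} {Z : Type*} (c : Fin m ⊕ Fin n → Z)
    (z : Fin m ⊕ Fin n) : ∃ j, (c ∘ finSumFinEquiv.symm) j = c z :=
  ⟨finSumFinEquiv z, by simp⟩

theorem exists_isKStepCoupling_of_wlColour {M N : FinLMMC d} (hM : IsLMMC M) (hN : IsLMMC N)
    (k : ℕ) : ∃ ν, IsKStepCoupling M.kernel N.kernel k ν ∧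
      ∀ p, wlColour M N k (.inl p.1) = wlColour M N k (.inr p.2) →
        ∀ r, ν p r ≠ 0 → M.label r.1 = N.label r.2 := by
  induction k with
  | zero =>
    refine ⟨_, .zero (fun p r => if r = p then 1 else 0) fun _ _ => rfl, fun p hp r hr => ?_⟩
    have : r = p := by
      by_contra h
      simp [h] at hr
    exact this ▸ hp
  | succ k ih =>
    obtain ⟨ν', hν', ih⟩ := ih
    have key : ∀ p : Fin M.n × Fin N.n, ∃ π : Fin M.n × Fin N.n → ℝ,
        IsCouplingFn π (M.kernel p.1) (N.kernel p.2) ∧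
        (wlColour M N (k + 1) (.inl p.1) = wlColour M N (k + 1) (.inr p.2) →
          ∀ s, π s ≠ 0 → wlColour M N k (.inl s.1) = wlColour M N k (.inr s.2)) := by
      intro p
      by_cases hp : wlColour M N (k + 1) (.inl p.1) = wlColour M N (k + 1) (.inr p.2)
      · obtain ⟨π, hπ, hs⟩ := exists_isCouplingFn_of_sum_colourIndicator (hM.1 p.1) (hN.1 p.2)
          (fun x => exists_finSumFinEquiv_symm_eq (wlColour M N k) (.inl x))
          (fun y => exists_finSumFinEquiv_symm_eq (wlColour M N k) (.inr y)) hp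
        exact ⟨π, hπ, fun _ => hs⟩
      · exact ⟨_, isCouplingFn_mul (hM.1 _) (hN.1 _) (hM.2.1 _) (hN.2.1 _), fun h => absurd h hp⟩
    choose ν₁ hν₁ hs using key
    refine ⟨_, .succ k ν' ν₁ _ hν' hν₁ fun _ _ => rfl, fun p hp r hr => ?_⟩
    obtain ⟨s, -, hsr⟩ := exists_ne_zero_of_sum_ne_zero hr
    exact ih s (hs p hp s (left_ne_zero_of_mul hsr)) r (right_ne_zero_of_mul hsr)

theorem dWLM_eq_zero_of_wlColour {M N : FinLMMC d} (hM : IsLMMC M) (hN : IsLMMC N) {k : ℕ}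
    (h : ∑ x, M.μ x • colourIndicator (wlColour M N k ∘ finSumFinEquiv.symm)
        (wlColour M N k (.inl x))
      = ∑ y, N.μ y • colourIndicator (wlColour M N k ∘ finSumFinEquiv.symm)
        (wlColour M N k (.inr y))) : dWLM k M N = 0 := by
  obtain ⟨γ, hγ, hγs⟩ := exists_isCouplingFn_of_sum_colourIndicator hM.2.2.1 hN.2.2.1
    (fun x => exists_finSumFinEquiv_symm_eq (wlColour M N k) (.inl x))
    (fun y => exists_finSumFinEquiv_symm_eq (wlColour M N k) (.inr y)) h
  obtain ⟨ν, hν, hνs⟩ := exists_isKStepCoupling_of_wlColour hM hN k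
  refine le_antisymm (csInf_le ⟨0, fun r => nonneg_of_mem_couplingCosts⟩
    ⟨γ, ν, hγ, hν, (sum_eq_zero fun r _ => ?_).symm⟩) (dWLM_nonneg k M N)
  by_contra hr
  obtain ⟨p, -, hp⟩ := exists_ne_zero_of_sum_ne_zero (left_ne_zero_of_mul hr)
  exact right_ne_zero_of_mul hr (dist_eq_zero.2
    (hνs p (hγs p (left_ne_zero_of_mul hp)) r (right_ne_zero_of_mul hp)))

theorem exists_isMCNN_eq_of_dWLM_ne_zero {k : ℕ} {M N : FinLMMC d} (hM : IsLMMC M)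
    (hN : IsLMMC N) (h : dWLM k M N ≠ 0) (a b : ℝ) :
    ∃ f, IsMCNN d k f ∧ f M = a ∧ f N = b := by
  classical
  choose φ hφ hφe using fun i => (Set.finite_range (wlColour M N i)).exists_lipschitzWith_eqOn
    (colourIndicator (wlColour M N i ∘ finSumFinEquiv.symm))
  have hφ' : ∀ i z, φ i (wlColour M N i z)
      = colourIndicator (wlColour M N i ∘ finSumFinEquiv.symm) (wlColour M N i z) :=
    fun i z => (hφe i (Set.mem_range_self z)).symm
  have hlM : ∀ i x, mcnnLabel (dimSeq d fun _ => M.n + N.n) φ M i x = wlColour M N i (.inl x) := by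
    intro i
    induction i with
    | zero => exact fun x => rfl
    | succ i ih =>
      exact fun x => sum_congr rfl fun x' _ => congrArg _ ((congrArg _ (ih x')).trans (hφ' _ _))
  have hlN : ∀ i y, mcnnLabel (dimSeq d fun _ => M.n + N.n) φ N i y = wlColour M N i (.inr y) := by
    intro i
    induction i with
    | zero => exact fun x => rfl
    | succ i ih =>
      exact fun x => sum_congr rfl fun x' _ => congrArg _ ((congrArg _ (ih x')).trans (hφ' _ _))
  set u := ∑ x, M.μ x • colourIndicator (wlColour M N k ∘ finSumFinEquiv.symm)
    (wlColour M N k (.inl x)) with hu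
  set v := ∑ y, N.μ y • colourIndicator (wlColour M N k ∘ finSumFinEquiv.symm)
    (wlColour M N k (.inr y)) with hv
  have huv : u ≠ v := fun huv => h (dWLM_eq_zero_of_wlColour hM hN huv)
  obtain ⟨ψ, hψ, hψe⟩ := (Set.toFinite {u, v}).exists_lipschitzWith_eqOn
    (fun w => if w = u then a else b)
  have hMu : ∑ x, M.μ x • φ k (mcnnLabel (dimSeq d fun _ => M.n + N.n) φ M k x) = u :=
    sum_congr rfl fun x _ => congrArg _ ((congrArg _ (hlM k x)).trans (hφ' _ _))
  have hNv : ∑ x, N.μ x • φ k (mcnnLabel (dimSeq d fun _ => M.n + N.n) φ N k x) = v :=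
    sum_congr rfl fun x _ => congrArg _ ((congrArg _ (hlN k x)).trans (hφ' _ _))
  refine ⟨_, ⟨fun _ => M.n + N.n, φ, ψ, hφ, hψ, fun _ => rfl⟩, ?_, ?_⟩
  · refine (congrArg ψ hMu).trans ((hψe (by simp)).symm.trans ?_)
    simp
  · refine (congrArg ψ hNv).trans ((hψe (by simp)).symm.trans ?_)
    simp [huv.symm]

end Separation

section StoneWeierstrass

/-- A lattice version of the Stone–Weierstrass theorem for sets that are sequentially compact
with respect to a distance function that need not satisfy the triangle inequality. -/
theorem exists_abs_sub_lt_of_lattice {A : Type*} {dd : A → A → ℝ} {K : Set A}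
    (hsymm : ∀ x y, dd x y = dd y x) (hnonneg : ∀ x y, 0 ≤ dd x y) (hK : SeqCompactIn dd K)
    {L : Set (A → ℝ)}
    (hlip : ∀ h ∈ L, ∃ C : ℝ, 0 < C ∧ ∀ x ∈ K, ∀ y ∈ K, |h x - h y| ≤ C * dd x y)
    (hsup : ∀ g ∈ L, ∀ h ∈ L, (fun x => max (g x) (h x)) ∈ L)
    (hinf : ∀ g ∈ L, ∀ h ∈ L, (fun x => min (g x) (h x)) ∈ L)
    (hconst : ∀ a : ℝ, (fun _ => a) ∈ L)
    (hsep : ∀ x ∈ K, ∀ y ∈ K, dd x y ≠ 0 → ∀ a b : ℝ, ∃ h ∈ L, h x = a ∧ h y = b)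
    {f : A → ℝ} (hf : ContinuousOnPD dd K f) {ε : ℝ} (hε : 0 < ε) :
    ∃ h ∈ L, ∀ x ∈ K, |f x - h x| < ε := by
  rcases K.eq_empty_or_nonempty with rfl | ⟨x₀, hx₀⟩
  · exact ⟨_, hconst 0, by simp⟩
  let I := {g : A → ℝ // ∀ x ∈ K, ∀ y ∈ K, |g x - g y| ≤ dd x y}
  let _ : TopologicalSpace I := ⊥
  have : DiscreteTopology I := ⟨rfl⟩
  let Φ : K → BoundedContinuousFunction I ℝ := fun x =>
    BoundedContinuousFunction.ofNormedAddCommGroupDiscrete (fun g : I => g.1 x - g.1 x₀)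
      (dd x x₀) fun g => g.2 x x.2 x₀ hx₀
  let _ : PseudoMetricSpace K := PseudoMetricSpace.induced Φ inferInstance
  have hdist : ∀ x y : K, dist x y ≤ dd x y := fun x y =>
    (BoundedContinuousFunction.dist_le (hnonneg _ _)).2 fun g => by
      rw [Real.dist_eq]
      simpa [Φ] using g.2 x x.2 y y.2
  have hle : ∀ (g : I) (x y : K), |g.1 x - g.1 y| ≤ dist x y := fun g x y => by
    have := (Φ x).dist_coe_le_dist (g := Φ y) g
    rw [Real.dist_eq] at this
    change |(g.1 x - g.1 x₀) - (g.1 y - g.1 x₀)| ≤ dist x y at this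
    rwa [sub_sub_sub_cancel_right] at this
  have hcont : ∀ h ∈ L, Continuous fun x : K => h x := fun h hh => by
    obtain ⟨C, hC, hCle⟩ := hlip h hh
    refine LipschitzWith.continuous (K := ⟨C, hC.le⟩) (LipschitzWith.of_dist_le_mul fun x y => ?_)
    have := hle ⟨fun z => h z / C, fun x hx y hy => by
      rw [← sub_div, abs_div, abs_of_pos hC, div_le_iff₀' hC]
      exact hCle x hx y hy⟩ x y
    rw [← sub_div, abs_div, abs_of_pos hC, div_le_iff₀' hC] at this
    exact this
  have hzero : ∀ x y : K, Inseparable x y → dd x y = 0 := fun x y hxy => by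
    by_contra h
    obtain ⟨g, hg, hgx, hgy⟩ := hsep x x.2 y y.2 h 0 1
    have := (hxy.map (hcont g hg)).eq
    simp [hgx, hgy] at this
  have hff : ∀ x y : K, dd x y = 0 → f x = f y := fun x y hxy => by
    by_contra h
    obtain ⟨δ, hδ, H⟩ := hf x x.2 |f x - f y| (abs_pos.2 (sub_ne_zero.2 h))
    exact lt_irrefl _ (H y y.2 (hxy ▸ hδ))
  have hsub : ∀ u : ℕ → K, ∃ a : K, ∃ s : ℕ → ℕ, StrictMono s ∧
      Filter.Tendsto (fun n => u (s n)) Filter.atTop (nhds a) ∧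
      Filter.Tendsto (fun n => f (u (s n))) Filter.atTop (nhds (f a)) := fun u => by
    obtain ⟨a, ha, s, hs, hlim⟩ := hK (fun n => u n) fun n => (u n).2
    refine ⟨⟨a, ha⟩, s, hs, ?_, ?_⟩
    · rw [tendsto_iff_dist_tendsto_zero]
      exact squeeze_zero (fun _ => dist_nonneg) (fun n => hdist _ _) hlim
    · rw [Metric.tendsto_atTop]
      intro η hη
      obtain ⟨δ, hδ, H⟩ := hf a ha η hη
      obtain ⟨n₀, hn₀⟩ := (hlim.eventually_lt_const hδ).exists_forall_of_atTop
      refine ⟨n₀, fun n hn => ?_⟩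
      rw [dist_comm, Real.dist_eq]
      exact H _ (u (s n)).2 (by rw [hsymm]; exact hn₀ n hn)
  have : CompactSpace K := compactSpace_iff_seqCompactSpace.2 ⟨fun u _ => by
    obtain ⟨a, s, hs, hlim, -⟩ := hsub u
    exact ⟨a, Set.mem_univ _, s, hs, hlim⟩⟩
  have : CompactSpace (SeparationQuotient K) := Quotient.compactSpace
  have hfc : Continuous fun x : K => f x := by
    refine continuous_iff_seqContinuous.2 fun u x hu => ?_
    refine Filter.tendsto_of_subseq_tendsto fun ns hns => ?_
    obtain ⟨a, s, hs, hlim, hflim⟩ := hsub (u ∘ ns)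
    have hax : Inseparable a x :=
      tendsto_nhds_unique_inseparable hlim ((hu.comp hns).comp hs.tendsto_atTop)
    exact ⟨s, hff a x (hzero a x hax) ▸ hflim⟩
  let S : Set C(SeparationQuotient K, ℝ) := {g | ∃ h ∈ L, ∀ x : K, g (.mk x) = h x}
  have hS : ∀ h ∈ L, ∃ g ∈ S, ∀ x : K, g (.mk x) = h x := fun h hh =>
    ⟨⟨SeparationQuotient.lift (fun x : K => h x) fun x y hxy => (hxy.map (hcont h hh)).eq,
      SeparationQuotient.continuous_lift (hcont h hh)⟩, ⟨h, hh, fun _ => rfl⟩, fun _ => rfl⟩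
  have hdense : closure S = ⊤ := by
    refine ContinuousMap.sublattice_closure_eq_top S ?_ ?_ ?_ ?_
    · obtain ⟨g, hg, -⟩ := hS _ (hconst 0)
      exact ⟨g, hg⟩
    · rintro g₁ ⟨h₁, hh₁, hg₁⟩ g₂ ⟨h₂, hh₂, hg₂⟩
      exact ⟨_, hinf h₁ hh₁ h₂ hh₂, fun x => by simp [hg₁, hg₂]⟩
    · rintro g₁ ⟨h₁, hh₁, hg₁⟩ g₂ ⟨h₂, hh₂, hg₂⟩
      exact ⟨_, hsup h₁ hh₁ h₂ hh₂, fun x => by simp [hg₁, hg₂]⟩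
    · intro v x y
      obtain ⟨x, rfl⟩ := SeparationQuotient.surjective_mk x
      obtain ⟨y, rfl⟩ := SeparationQuotient.surjective_mk y
      by_cases hxy : dd x y = 0
      · have hmk : SeparationQuotient.mk x = SeparationQuotient.mk y := by
          refine SeparationQuotient.mk_eq_mk.2 (Metric.inseparable_iff.2 ?_)
          exact le_antisymm ((hdist x y).trans_eq hxy) dist_nonneg
        obtain ⟨g, hg, hgh⟩ := hS _ (hconst (v (.mk x)))
        exact ⟨g, hg, hgh x, by rw [hgh y, hmk]⟩
      · obtain ⟨h, hh, hx, hy⟩ := hsep x x.2 y y.2 hxy (v (.mk x)) (v (.mk y))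
        obtain ⟨g, hg, hgh⟩ := hS h hh
        exact ⟨g, hg, (hgh x).trans hx, (hgh y).trans hy⟩
  let F : C(SeparationQuotient K, ℝ) :=
    ⟨SeparationQuotient.lift (fun x : K => f x) fun x y hxy => (hxy.map hfc).eq,
      SeparationQuotient.continuous_lift hfc⟩
  have hF : F ∈ closure S := hdense ▸ Set.mem_univ F
  obtain ⟨g, ⟨h, hh, hgh⟩, hFg⟩ := Metric.mem_closure_iff.1 hF ε hε
  refine ⟨h, hh, fun x hx => ?_⟩
  have := (ContinuousMap.dist_apply_le_dist (f := F) (g := g) (.mk ⟨x, hx⟩)).trans_lt hFg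
  rwa [hgh, Real.dist_eq] at this

end StoneWeierstrass

end

/-!
STATEMENT 15 (Universal approximation of `k`-layer MCNNs): Fix `d ≥ 1` and `k ∈ ℕ`, and let
`K` be a compact subset of the pseudometric space `(M^L(ℝ^d), d_WL^{(k)})` of ℝ^d-labeled
measure Markov chains on finite state spaces. Then the restrictions to `K` of `k`-layer
Markov chain neural networks are dense in `C(K,ℝ)` with respect to the supremum norm
(so that the closure of `NN_k(ℝ^d)|_K` is `C(K,ℝ)`).
-/
theorem mcnn_universal_approximation (d : ℕ) (hd : 1 ≤ d) (k : ℕ)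
    (K : Set (FinLMMC d)) (hmem : ∀ M ∈ K, IsLMMC M)
    (hK : SeqCompactIn (dWLM k) K) :
    ∀ f : FinLMMC d → ℝ, ContinuousOnPD (dWLM k) K f →
      ∀ ε > 0, ∃ (t : ℕ → ℕ)
        (φ : (i : ℕ) → EuclideanSpace ℝ (Fin (dimSeq d t i)) →
          EuclideanSpace ℝ (Fin (dimSeq d t (i + 1))))
        (ψ : EuclideanSpace ℝ (Fin (dimSeq d t (k + 1))) → ℝ),
        (∀ i, ∃ c : NNReal, LipschitzWith c (φ i)) ∧ (∃ c : NNReal, LipschitzWith c ψ) ∧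
        ∀ M ∈ K, |f M - mcnnOut (dimSeq d t) k φ ψ M| < ε := by
  intro f hf ε hε
  obtain ⟨h, ⟨t, φ, ψ, hφ, hψ, H⟩, hlt⟩ := exists_abs_sub_lt_of_lattice (L := {h | IsMCNN d k h})
    (dWLM_comm k) (dWLM_nonneg k) hK
    (fun h hh => by
      obtain ⟨C, hC, hle⟩ := IsMCNN.exists_abs_sub_le hh
      exact ⟨C, hC, fun M hM N hN => hle M N (hmem M hM) (hmem N hN)⟩)
    (fun _ hg _ hh => IsMCNN.comp₂ hg hh lipschitzWith_max)
    (fun _ hg _ hh => IsMCNN.comp₂ hg hh lipschitzWith_min)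
    isMCNN_const
    (fun M hM N hN h a b => exists_isMCNN_eq_of_dWLM_ne_zero (hmem M hM) (hmem N hN) h a b)
    hf hε
  exact ⟨t, φ, ψ, hφ, hψ, fun M hM => H M ▸ hlt M hM⟩
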